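/- arXiv:2201.07270 — 3 statements merged into one kernel-verified Lean document; each statement's English description precedes it below -/
import Mathlib

section
/- For every integer k ≥ 1 and every real η > 0, BD_k ⊆ SH_k. -/
open MvPolynomial

/-- The set of monomials `z₁^{m₁}⋯z_k^{m_k}` with all `m_j ∈ {0,1,2}`;
its span is the space `R_k = ℂ[z₁,…,z_k]_{≤2,…,2}`. -/
def Rmonomials (k : ℕ) : Set (MvPolynomial (Fin k) ℂ) :=
  { m | ∃ e : Fin k →₀ ℕ, (∀ j, e j ≤ 2) ∧ m = monomial e 1 }

/-- The space `R_k = ℂ[z₁,…,z_k]_{≤2,…,2}`. -/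
noncomputable def Rspace (k : ℕ) : Submodule ℂ (MvPolynomial (Fin k) ℂ) :=
  Submodule.span ℂ (Rmonomials k)

/-- The set `BD_k` of polynomials of `R_k` admitting a boundary decomposition
`p = (z₁+η)F₁ + ∑_{i=2}^k (z_{i−1}−z_i−1)F_i` with `F₁` invariant under `z₁ ↦ −z₁`,
`(z₁+η)F₁ ∈ R_k`, each `F_i` (for `i ≥ 2`) invariant under exchanging `z_{i−1}, z_i`,
and `(z_{i−1}−z_i−1)F_i ∈ R_k`. -/
def BDset (k : ℕ) [NeZero k] (η : ℝ) : Set (MvPolynomial (Fin k) ℂ) :=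
  { p | p ∈ Rspace k ∧
      ∃ F : Fin k → MvPolynomial (Fin k) ℂ,
        (aeval (fun j : Fin k => if j = 0 then -(X 0) else X j) (F 0) = F 0) ∧
        ((X 0 + C (η : ℂ)) * F 0 ∈ Rspace k) ∧
        (∀ i : Fin k, i ≠ 0 →
          rename (Equiv.swap (i - 1) i) (F i) = F i ∧
            (X (i - 1) - X i - 1) * F i ∈ Rspace k) ∧
        p = (X 0 + C (η : ℂ)) * F 0 +
              ∑ i ∈ Finset.univ.filter (fun i : Fin k => i ≠ 0),
                (X (i - 1) - X i - 1) * F i }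

/-- The linear map `L_{r,k}`: sum, over subsets `S` of `{1,…,k}` of size `k−r`, of the
substitution of `p` at the tuple whose coordinates in `S` (in increasing order) are
`−η, −η−1, …, −η−(k−r−1)` and whose remaining coordinates (in increasing order) are the
variables `x₁,…,x_r` (indexed here by `0,…,r−1` in `MvPolynomial ℕ ℂ`). -/
noncomputable def Lmap (k : ℕ) (η : ℝ) (r : ℕ) (p : MvPolynomial (Fin k) ℂ) :
    MvPolynomial ℕ ℂ :=
  ∑ S ∈ Finset.powersetCard (k - r) (Finset.univ : Finset (Fin k)),
    aeval (fun j : Fin k =>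
      if j ∈ S then C (-(η : ℂ) - ((S.filter (fun i => i < j)).card : ℂ))
      else X (((Finset.univ \ S).filter (fun i => i < j)).card)) p

/-- The set `SH_k`: polynomials `p ∈ R_k` such that for all `0 ≤ r ≤ k` the coefficient
of `x₁²⋯x_r²` in `L_{r,k}(p)` vanishes. -/
def SHset (k : ℕ) (η : ℝ) : Set (MvPolynomial (Fin k) ℂ) :=
  { p | p ∈ Rspace k ∧
      ∀ r ≤ k, coeff (∑ i ∈ Finset.range r, Finsupp.single i 2) (Lmap k η r p) = 0 }

/-- The set `L_k^i` of monomials `z₁^{m₁}⋯z_k^{m_k}` with all `m_j ∈ {0,1,2}` and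
exponent of `z_k` equal to `i`. -/
def Lset (k : ℕ) (i : ℕ) : Set (MvPolynomial (Fin k) ℂ) :=
  { m | ∃ e : Fin k →₀ ℕ, (∀ j, e j ≤ 2) ∧ (∀ j : Fin k, (j : ℕ) = k - 1 → e j = i) ∧
      m = monomial e 1 }

/-- The set `W_k` consisting of the monomial `z₁²⋯z_k²` together with, for each `j`, the
monomial with exponent `2` in every variable except exponent `1` in `z_j`. -/
def Wset (k : ℕ) : Set (MvPolynomial (Fin k) ℂ) :=
  { m | m = monomial (Finsupp.equivFunOnFinite.symm fun _ : Fin k => 2) 1 ∨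
      ∃ j : Fin k,
        m = monomial (Finsupp.equivFunOnFinite.symm fun i : Fin k => if i = j then 1 else 2) 1 }

lemma degreeOf_le_two_of_mem_Rspace {k : ℕ} {p : MvPolynomial (Fin k) ℂ} (hp : p ∈ Rspace k)
    (j : Fin k) : degreeOf j p ≤ 2 := by
  induction hp using Submodule.span_induction with
  | mem x hx =>
    obtain ⟨e, he, rfl⟩ := hx
    rw [degreeOf_monomial_eq e j one_ne_zero]
    exact he j
  | zero => simp
  | add x y _ _ hx hy => exact (degreeOf_add_le j x y).trans (max_le hx hy)
  | smul c x _ hx =>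
    rw [smul_eq_C_mul]
    exact (degreeOf_C_mul_le x j c).trans hx

lemma degreeOf_aeval_le_degreeOf {σ τ R : Type*} [Fintype σ] [CommSemiring R]
    (g : σ → MvPolynomial τ R) (F : MvPolynomial σ R) (j : σ) (m : τ)
    (hj : degreeOf m (g j) ≤ 1) (hne : ∀ i, i ≠ j → degreeOf m (g i) = 0) :
    degreeOf m (aeval g F) ≤ degreeOf j F := by
  classical
  rw [aeval_def, eval₂_eq']
  refine (degreeOf_sum_le m _ _).trans (Finset.sup_le fun d hd => ?_)
  rw [algebraMap_eq]
  refine (degreeOf_C_mul_le _ m _).trans ((degreeOf_prod_le m _ _).trans ?_)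
  calc ∑ i, degreeOf m (g i ^ d i) ≤ ∑ i, d i * degreeOf m (g i) :=
        Finset.sum_le_sum fun i _ => degreeOf_pow_le m _ _
    _ = d j * degreeOf m (g j) :=
        Finset.sum_eq_single j (fun i _ hi => by simp [hne i hi]) (by simp)
    _ ≤ d j := by nlinarith
    _ ≤ degreeOf j F := monomial_le_degreeOf j hd

lemma coeff_eq_zero_of_degreeOf_lt {σ R : Type*} [CommSemiring R] {p : MvPolynomial σ R}
    {d : σ →₀ ℕ} (m : σ) (h : degreeOf m p < d m) : coeff d p = 0 := by
  by_contra hne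
  exact absurd (monomial_le_degreeOf m (mem_support_iff.2 hne)) (not_le.2 h)

lemma coeff_aeval_neg_single {σ : Type*} [Fintype σ] [DecidableEq σ] {R : Type*} [CommRing R]
    (a : σ) (F : MvPolynomial σ R) (e : σ →₀ ℕ) :
    coeff e (aeval (fun j : σ => if j = a then -(X a) else X j) F) =
      (-1) ^ e a * coeff e F := by
  induction F using MvPolynomial.induction_on' with
  | add p q hp hq => simp only [map_add, coeff_add, hp, hq, mul_add]
  | monomial u c =>
    have h : aeval (fun j : σ => if j = a then -(X a) else X j) (monomial u c) =
        monomial u ((-1) ^ u a * c) := by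
      have h1 : ∀ j : σ, (if j = a then -(X a) else X j : MvPolynomial σ R) ^ u j =
          (if j = a then C ((-1) ^ u a) else 1) * X j ^ u j := by
        intro j
        split_ifs with hj
        · subst hj
          rw [neg_pow, map_pow, map_neg, map_one]
        · rw [one_mul]
      rw [aeval_monomial, Finsupp.prod_fintype _ _ (by simp), Finset.prod_congr rfl fun j _ => h1 j,
        Finset.prod_mul_distrib, Finset.prod_ite_eq' Finset.univ a, if_pos (Finset.mem_univ a),
        algebraMap_eq, monomial_eq (s := u), Finsupp.prod_fintype _ _ (by simp), map_mul]
      ring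
    rw [h, coeff_monomial, coeff_monomial]
    split_ifs with hu
    · rw [hu]
    · simp

/-- The tuple of polynomials substituted in the summand of `Lmap` indexed by `S`. -/
noncomputable def substTuple {k : ℕ} (η : ℝ) (S : Finset (Fin k)) (j : Fin k) :
    MvPolynomial ℕ ℂ :=
  if j ∈ S then C (-(η : ℂ) - ((S.filter (fun i => i < j)).card : ℂ))
  else X (((Finset.univ \ S).filter (fun i => i < j)).card)

lemma card_filter_lt_injOn {k : ℕ} {T : Finset (Fin k)} {i j : Fin k} (hi : i ∈ T) (hj : j ∈ T)
    (h : (T.filter (fun l => l < i)).card = (T.filter (fun l => l < j)).card) : i = j := by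
  have key : ∀ a b : Fin k, a ∈ T → a < b →
      (T.filter (fun l => l < a)).card < (T.filter (fun l => l < b)).card := by
    intro a b ha hab
    refine Finset.card_lt_card ((Finset.ssubset_iff_of_subset fun l hl => ?_).2 ⟨a, ?_, ?_⟩)
    · simp only [Finset.mem_filter] at hl ⊢
      exact ⟨hl.1, hl.2.trans hab⟩
    · simp [ha, hab]
    · simp
  rcases lt_trichotomy i j with hij | hij | hij
  · exact absurd h (key i j hi hij).ne
  · exact hij
  · exact absurd h (key j i hj hij).ne'

lemma degreeOf_aeval_substTuple_le {k : ℕ} (η : ℝ) {S : Finset (Fin k)} {j : Fin k} (hj : j ∉ S)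
    (F : MvPolynomial (Fin k) ℂ) :
    degreeOf ((Finset.univ \ S).filter (fun i => i < j)).card (aeval (substTuple η S) F) ≤
      degreeOf j F := by
  refine degreeOf_aeval_le_degreeOf _ F j _ ?_ fun i hij => ?_
  · rw [substTuple, if_neg hj, degreeOf_X, if_pos rfl]
  · rw [substTuple]
    split_ifs with hi
    · exact degreeOf_C _ _
    · rw [degreeOf_X, if_neg]
      intro h
      exact hij (card_filter_lt_injOn (by simp [hi]) (by simp [hj]) h.symm)

lemma sum_single_two_apply {r m : ℕ} (hm : m < r) :
    (∑ i ∈ Finset.range r, Finsupp.single i 2 : ℕ →₀ ℕ) m = 2 := by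
  rw [Finsupp.finsetSum_apply, Finset.sum_eq_single m]
  · simp
  · intro b _ hb
    simp [hb]
  · simp [hm]

lemma card_filter_compl_lt {k r : ℕ} (hr : r ≤ k) {S : Finset (Fin k)} (hS : S.card = k - r)
    {j : Fin k} (hj : j ∉ S) : ((Finset.univ \ S).filter (fun i => i < j)).card < r := by
  have h : (Finset.univ \ S).card = r := by
    rw [Finset.card_sdiff_of_subset (Finset.subset_univ S), hS, Finset.card_univ, Fintype.card_fin]
    omega
  calc _ < (Finset.univ \ S).card := Finset.card_lt_card
        ((Finset.ssubset_iff_of_subset (Finset.filter_subset _ _)).2 ⟨j, by simp [hj], by simp⟩)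
    _ = r := h

lemma coeff_aeval_substTuple_eq_zero {k r : ℕ} (η : ℝ) (hr : r ≤ k) {S : Finset (Fin k)}
    (hS : S.card = k - r) {j : Fin k} (hj : j ∉ S) {F : MvPolynomial (Fin k) ℂ}
    (hF : degreeOf j F ≤ 1) :
    coeff (∑ i ∈ Finset.range r, Finsupp.single i 2) (aeval (substTuple η S) F) = 0 := by
  refine coeff_eq_zero_of_degreeOf_lt ((Finset.univ \ S).filter (fun i => i < j)).card ?_
  rw [sum_single_two_apply (card_filter_compl_lt hr hS hj)]
  have := degreeOf_aeval_substTuple_le η hj F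
  omega

lemma substTuple_sub_eq_one {k : ℕ} (η : ℝ) {S : Finset (Fin k)} {a b : Fin k}
    (hab : (a : ℕ) + 1 = b) (ha : a ∈ S) (hb : b ∈ S) :
    substTuple η S a - substTuple η S b - 1 = 0 := by
  have h : S.filter (fun i => i < b) = insert a (S.filter (fun i => i < a)) := by
    ext i
    simp only [Finset.mem_filter, Finset.mem_insert, Fin.lt_def, Fin.ext_iff]
    constructor
    · rintro ⟨hi, h⟩
      by_cases h' : (i : ℕ) = a
      · exact Or.inl h'
      · exact Or.inr ⟨hi, by omega⟩
    · rintro (h | ⟨hi, h⟩)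
      · exact ⟨(Fin.ext h : i = a) ▸ ha, by omega⟩
      · exact ⟨hi, by omega⟩
  rw [substTuple, substTuple, if_pos ha, if_pos hb, h, Finset.card_insert_of_notMem (by simp),
    ← C_1, ← C_sub, ← C_sub, ← C_0]
  congr 1
  push_cast
  ring

lemma card_filter_lt_map_swap {k : ℕ} {T : Finset (Fin k)} {a b j : Fin k}
    (hab : (a : ℕ) + 1 = b) (hT : ¬ (a ∈ T ∧ b ∈ T)) (hj : Equiv.swap a b j ∈ T) :
    ((T.map (Equiv.swap a b).toEmbedding).filter (fun i => i < j)).card =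
      (T.filter (fun i => i < Equiv.swap a b j)).card := by
  rw [Finset.filter_map, Finset.card_map]
  congr 1
  refine Finset.filter_congr fun i hi => ?_
  simp only [Function.comp, Equiv.coe_toEmbedding, Equiv.swap_apply_def] at hj ⊢
  split_ifs at hj ⊢ <;> grind

lemma substTuple_map_swap {k : ℕ} (η : ℝ) {S : Finset (Fin k)} {a b : Fin k}
    (hab : (a : ℕ) + 1 = b) (hS : ¬ (a ∈ S ∧ b ∈ S)) (hS' : ¬ (a ∉ S ∧ b ∉ S)) (j : Fin k) :
    substTuple η (S.map (Equiv.swap a b).toEmbedding) j =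
      substTuple η S (Equiv.swap a b j) := by
  have hmem : j ∈ S.map (Equiv.swap a b).toEmbedding ↔ Equiv.swap a b j ∈ S := by
    rw [Finset.mem_map_equiv, Equiv.symm_swap]
  have hcompl : Finset.univ \ S.map (Equiv.swap a b).toEmbedding =
      (Finset.univ \ S).map (Equiv.swap a b).toEmbedding := by
    ext i
    simp [Finset.mem_map_equiv, -Finset.mem_map]
  by_cases hj : Equiv.swap a b j ∈ S
  · rw [substTuple, substTuple, if_pos (hmem.2 hj), if_pos hj, card_filter_lt_map_swap hab hS hj]
  · rw [substTuple, substTuple, if_neg (mt hmem.1 hj), if_neg hj, hcompl,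
      card_filter_lt_map_swap hab (by simpa using hS') (by simp [hj])]

lemma Lmap_eq_sum_substTuple (k : ℕ) (η : ℝ) (r : ℕ) (p : MvPolynomial (Fin k) ℂ) :
    Lmap k η r p =
      ∑ S ∈ Finset.powersetCard (k - r) Finset.univ, aeval (substTuple η S) p := rfl

lemma degreeOf_factor_le_one {k : ℕ} {j : Fin k} {l F : MvPolynomial (Fin k) ℂ}
    (hl : degreeOf j l = 1) (h : l * F ∈ Rspace k) : degreeOf j F ≤ 1 := by
  rcases eq_or_ne F 0 with rfl | hF
  · simp
  have hl0 : l ≠ 0 := by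
    rintro rfl
    simp at hl
  have h2 := degreeOf_le_two_of_mem_Rspace h j
  rw [degreeOf_mul_eq hl0 hF] at h2
  omega

lemma degreeOf_eq_one_of_coeff {σ R : Type*} [CommRing R] [Nontrivial R] (j : σ)
    {l : MvPolynomial σ R} (h : degreeOf j l ≤ 1) (hc : coeff (Finsupp.single j 1) l ≠ 0) :
    degreeOf j l = 1 := by
  have := monomial_le_degreeOf j (mem_support_iff.2 hc)
  simp at this
  omega

lemma coeff_Lmap_boundary_eq_zero {k r : ℕ} [NeZero k] (η : ℝ) (hr : r ≤ k)
    {F : MvPolynomial (Fin k) ℂ}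
    (hinv : aeval (fun j : Fin k => if j = 0 then -(X 0) else X j) F = F)
    (hF : (X 0 + C (η : ℂ)) * F ∈ Rspace k) :
    coeff (∑ i ∈ Finset.range r, Finsupp.single i 2)
      (Lmap k η r ((X 0 + C (η : ℂ)) * F)) = 0 := by
  have hX : degreeOf 0 (X 0 + C (η : ℂ) : MvPolynomial (Fin k) ℂ) ≤ 1 :=
    (degreeOf_add_le _ _ _).trans (by simp)
  have hdeg1 : degreeOf 0 F ≤ 1 := by
    refine degreeOf_factor_le_one (degreeOf_eq_one_of_coeff 0 hX ?_) hF
    simp [coeff_X, coeff_C, eq_comm]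
  have hdeg : degreeOf 0 F ≤ 0 := by
    rw [degreeOf_le_iff]
    intro e he
    have h1 := (monomial_le_degreeOf 0 he).trans hdeg1
    by_contra h0
    have h2 : e 0 = 1 := by omega
    have h3 := coeff_aeval_neg_single 0 F e
    rw [hinv, h2, pow_one, neg_one_mul, self_eq_neg] at h3
    exact mem_support_iff.1 he h3
  rw [Lmap_eq_sum_substTuple, coeff_sum]
  refine Finset.sum_eq_zero fun S hS => ?_
  by_cases h0 : (0 : Fin k) ∈ S
  · have : substTuple η S 0 = -C (η : ℂ) := by
      simp [substTuple, h0]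
    simp [this, ← algebraMap_eq]
  · refine coeff_aeval_substTuple_eq_zero η hr (Finset.mem_powersetCard.1 hS).2 h0 ?_
    exact (degreeOf_mul_le _ _ _).trans (by omega)

lemma coeff_Lmap_exchange_eq_zero {k r : ℕ} (η : ℝ) (hr : r ≤ k) {a b : Fin k}
    (hab : (a : ℕ) + 1 = b) {F : MvPolynomial (Fin k) ℂ}
    (hinv : rename (Equiv.swap a b) F = F) (hF : (X a - X b - 1) * F ∈ Rspace k) :
    coeff (∑ i ∈ Finset.range r, Finsupp.single i 2)
      (Lmap k η r ((X a - X b - 1) * F)) = 0 := by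
  have hne : a ≠ b := by
    rintro rfl
    omega
  have hX : ∀ c, degreeOf c (X a - X b - 1 : MvPolynomial (Fin k) ℂ) ≤ 1 := by
    intro c
    refine (degreeOf_sub_le _ _ _).trans (max_le ((degreeOf_sub_le _ _ _).trans (max_le ?_ ?_)) ?_)
    · rw [degreeOf_X]; split_ifs <;> simp
    · rw [degreeOf_X]; split_ifs <;> simp
    · rw [← C_1, degreeOf_C]; simp
  have h0 : ∀ c : Fin k, (0 : Fin k →₀ ℕ) ≠ Finsupp.single c 1 := fun c =>
    (Finsupp.single_ne_zero.2 one_ne_zero).symm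
  have ha : degreeOf a F ≤ 1 := by
    refine degreeOf_factor_le_one (degreeOf_eq_one_of_coeff a (hX a) ?_) hF
    simp [coeff_X, coeff_one, Finsupp.single_left_inj, hne.symm, h0]
  have hb : degreeOf b F ≤ 1 := by
    refine degreeOf_factor_le_one (degreeOf_eq_one_of_coeff b (hX b) ?_) hF
    simp [coeff_X, coeff_one, Finsupp.single_left_inj, hne, h0]
  set d : ℕ →₀ ℕ := ∑ i ∈ Finset.range r, Finsupp.single i 2 with hd
  set σ := Equiv.swap a b with hσ
  have hboth : ∀ S : Finset (Fin k), a ∈ S ∧ b ∈ S →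
      coeff d (aeval (substTuple η S) ((X a - X b - 1) * F)) = 0 := by
    rintro S ⟨haS, hbS⟩
    rw [map_mul, map_sub, map_sub, aeval_X, aeval_X, map_one,
      substTuple_sub_eq_one η hab haS hbS, zero_mul, coeff_zero]
  have hnone : ∀ S : Finset (Fin k), S.card = k - r → a ∉ S ∧ b ∉ S →
      coeff d (aeval (substTuple η S) ((X a - X b - 1) * F)) = 0 := by
    rintro S hS ⟨haS, hbS⟩
    have h1 : degreeOf b (X a * F) ≤ 1 :=
      (degreeOf_mul_le _ _ _).trans (by rw [degreeOf_X, if_neg hne.symm]; omega)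
    have h2 : degreeOf a (X b * F) ≤ 1 :=
      (degreeOf_mul_le _ _ _).trans (by rw [degreeOf_X, if_neg hne]; omega)
    rw [sub_mul, sub_mul, one_mul, map_sub, map_sub, coeff_sub, coeff_sub,
      coeff_aeval_substTuple_eq_zero η hr hS hbS h1, coeff_aeval_substTuple_eq_zero η hr hS haS h2,
      coeff_aeval_substTuple_eq_zero η hr hS haS ha, sub_zero, sub_zero]
  rw [Lmap_eq_sum_substTuple, coeff_sum]
  have hfix : ∀ S : Finset (Fin k), (a ∈ S ↔ b ∈ S) → S.map σ.toEmbedding = S := by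
    intro S h
    ext i
    rw [Finset.mem_map_equiv, hσ, Equiv.symm_swap, Equiv.swap_apply_def]
    split_ifs <;> grind
  refine Finset.sum_involution (fun S _ => S.map σ.toEmbedding) ?_ ?_ ?_ ?_
  · intro S hS
    have hS := (Finset.mem_powersetCard.1 hS).2
    by_cases h1 : a ∈ S ∧ b ∈ S
    · rw [hfix S (by tauto), hboth S h1, add_zero]
    by_cases h2 : a ∉ S ∧ b ∉ S
    · rw [hfix S (by tauto), hnone S hS h2, add_zero]
    have h3 : aeval (substTuple η (S.map σ.toEmbedding)) F = aeval (substTuple η S) F := by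
      conv_rhs => rw [← hinv, aeval_rename]
      congr 2
      funext j
      exact substTuple_map_swap η hab h1 h2 j
    have h4 : aeval (substTuple η S) ((X a - X b - 1) * F) +
        aeval (substTuple η (S.map σ.toEmbedding)) ((X a - X b - 1) * F) =
        C (-2) * aeval (substTuple η S) F := by
      have h5 : substTuple η (S.map σ.toEmbedding) a = substTuple η S b := by
        rw [substTuple_map_swap η hab h1 h2, Equiv.swap_apply_left]
      have h6 : substTuple η (S.map σ.toEmbedding) b = substTuple η S a := by
        rw [substTuple_map_swap η hab h1 h2, Equiv.swap_apply_right]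
      simp only [map_mul, map_sub, aeval_X, map_one, h3, h5, h6, map_neg, map_ofNat]
      ring
    rw [← coeff_add, h4, coeff_C_mul]
    by_cases haS : a ∈ S
    · rw [coeff_aeval_substTuple_eq_zero η hr hS (j := b) (by tauto) hb, mul_zero]
    · rw [coeff_aeval_substTuple_eq_zero η hr hS haS ha, mul_zero]
  · intro S hS hne0 hEq
    have hS := (Finset.mem_powersetCard.1 hS).2
    have h : a ∈ S ↔ b ∈ S := by
      conv_lhs => rw [← hEq, Finset.mem_map_equiv, hσ, Equiv.symm_swap, Equiv.swap_apply_left]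
    by_cases haS : a ∈ S
    · exact hne0 (hboth S ⟨haS, h.1 haS⟩)
    · exact hne0 (hnone S hS ⟨haS, mt h.2 haS⟩)
  · intro S hS
    simpa [Finset.mem_powersetCard] using hS
  · intro S _
    ext i
    simp [Finset.mem_map_equiv, -Finset.mem_map, hσ]

lemma Lmap_add (k : ℕ) (η : ℝ) (r : ℕ) (p q : MvPolynomial (Fin k) ℂ) :
    Lmap k η r (p + q) = Lmap k η r p + Lmap k η r q := by
  simp only [Lmap, map_add, Finset.sum_add_distrib]

lemma Lmap_sum (k : ℕ) (η : ℝ) (r : ℕ) {ι : Type*} (s : Finset ι)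
    (f : ι → MvPolynomial (Fin k) ℂ) :
    Lmap k η r (∑ i ∈ s, f i) = ∑ i ∈ s, Lmap k η r (f i) := by
  simp only [Lmap, map_sum]
  exact Finset.sum_comm

/-- Proposition 3.6 of the paper: `BD_k ⊆ SH_k`. -/
theorem BD_subset_SH (k : ℕ) [NeZero k] (η : ℝ) (hη : 0 < η) :
    BDset k η ⊆ SHset k η := by
  rintro p ⟨hp, F, hinv, hF0, hF, rfl⟩
  refine ⟨hp, fun r hr => ?_⟩
  rw [Lmap_add, Lmap_sum, coeff_add, coeff_sum, coeff_Lmap_boundary_eq_zero η hr hinv hF0,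
    zero_add]
  refine Finset.sum_eq_zero fun i hi => ?_
  have hi0 : i ≠ 0 := (Finset.mem_filter.1 hi).2
  refine coeff_Lmap_exchange_eq_zero η hr ?_ (hF i hi0).1 (hF i hi0).2
  rw [Fin.val_sub_one_of_ne_zero hi0]
  have : (i : ℕ) ≠ 0 := fun h => hi0 (Fin.ext (by simpa using h))
  omega
end

section
/- For every integer k ≥ 1 and every real η > 0, the ℂ-vector space BD_k has dimension 3^k − k − 1. -/
open MvPolynomial

section BoundaryDecomposition

variable {k : ℕ}

/-- The monomial `∏ Xᵢ ^ eᵢ` with exponents given by a plain function. -/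
noncomputable def mono (e : Fin k → ℕ) : MvPolynomial (Fin k) ℂ := ∏ i, X i ^ e i

lemma monomial_eq_mono (e : Fin k →₀ ℕ) : monomial e (1 : ℂ) = mono e := by
  rw [monomial_eq, Finsupp.prod_fintype _ _ (by simp)]
  simp [mono]

lemma mono_eq_monomial (e : Fin k → ℕ) :
    mono e = monomial (Finsupp.equivFunOnFinite.symm e) (1 : ℂ) := by
  rw [monomial_eq_mono]
  rfl

lemma X_mul_mono (e : Fin k → ℕ) (i : Fin k) :
    X i * mono e = mono (Function.update e i (e i + 1)) := by
  classical
  rw [mono, mono, ← Finset.mul_prod_erase _ _ (Finset.mem_univ i),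
    ← Finset.mul_prod_erase _ _ (Finset.mem_univ i), Function.update_self, pow_succ', mul_assoc]
  congr 2
  refine Finset.prod_congr rfl fun j hj => ?_
  rw [Function.update_of_ne (Finset.ne_of_mem_erase hj)]

lemma rename_mono (σ : Equiv.Perm (Fin k)) (e : Fin k → ℕ) :
    rename σ (mono e) = mono (e ∘ σ.symm) := by
  simp only [mono, map_prod, map_pow, rename_X]
  rw [← Equiv.prod_comp σ (fun i => (X i : MvPolynomial (Fin k) ℂ) ^ (e ∘ σ.symm) i)]
  simp

lemma Rspace_eq : Rspace k = restrictDegree (Fin k) ℂ 2 := by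
  apply le_antisymm
  · refine Submodule.span_le.2 ?_
    rintro _ ⟨e, he, rfl⟩
    rw [SetLike.mem_coe, mem_restrictDegree]
    intro s hs i
    rw [Finset.mem_singleton.1 (support_monomial_subset hs)]
    exact he i
  · intro p hp
    rw [mem_restrictDegree] at hp
    rw [p.as_sum]
    refine Submodule.sum_mem _ fun e he => ?_
    rw [← mul_one (coeff e p), ← smul_eq_mul, ← smul_monomial]
    exact Submodule.smul_mem _ _ (Submodule.subset_span ⟨e, hp e he, rfl⟩)

lemma mono_mem_Rspace {e : Fin k → ℕ} (he : ∀ i, e i ≤ 2) : mono e ∈ Rspace k := by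
  rw [mono_eq_monomial]
  exact Submodule.subset_span ⟨_, he, rfl⟩

lemma eq_sum_mono (p : MvPolynomial (Fin k) ℂ) :
    p = ∑ e ∈ p.support, coeff e p • mono e := by
  conv_lhs => rw [p.as_sum]
  refine Finset.sum_congr rfl fun e _ => ?_
  rw [← monomial_eq_mono, smul_monomial, smul_eq_mul, mul_one]

/-- A product with a factor having positive degree in `t` that stays in `Rspace` has a cofactor
of degree at most one in `t`. -/
lemma le_of_mul_mem_Rspace {l F : MvPolynomial (Fin k) ℂ} (h : l * F ∈ Rspace k)
    {e : Fin k →₀ ℕ} (he : e ∈ F.support) (hl : l ≠ 0) (t : Fin k) :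
    e t + degreeOf t l ≤ 2 := by
  have hF : F ≠ 0 := by rintro rfl; simp at he
  rw [Rspace_eq, mem_restrictDegree] at h
  have h1 : degreeOf t (l * F) ≤ 2 := degreeOf_le_iff.2 fun m hm => h m hm t
  rw [degreeOf_mul_eq hl hF] at h1
  have := monomial_le_degreeOf t he
  omega

lemma one_le_degreeOf {l : MvPolynomial (Fin k) ℂ} {t : Fin k}
    (h : coeff (Finsupp.single t 1) l ≠ 0) : 1 ≤ degreeOf t l := by
  simpa using monomial_le_degreeOf t (mem_support_iff.2 h)

lemma coeff_aeval_neg (i : Fin k) (F : MvPolynomial (Fin k) ℂ) (e : Fin k →₀ ℕ) :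
    coeff e (aeval (fun j : Fin k => if j = i then -(X i) else (X j : MvPolynomial (Fin k) ℂ)) F)
      = (-1) ^ e i * coeff e F := by
  have key : ∀ m : Fin k →₀ ℕ,
      aeval (fun j : Fin k => if j = i then -(X i) else (X j : MvPolynomial (Fin k) ℂ))
        (mono m) = ((-1 : ℂ) ^ m i) • mono m := by
    intro m
    simp only [mono, map_prod, map_pow, aeval_X]
    rw [← Finset.mul_prod_erase _ _ (Finset.mem_univ i),
      ← Finset.mul_prod_erase _ (fun j => (X j : MvPolynomial (Fin k) ℂ) ^ m j) (Finset.mem_univ i), if_pos rfl,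
      neg_pow, smul_eq_C_mul, C_pow, C_neg, C_1, mul_assoc]
    congr 2
    refine Finset.prod_congr rfl fun j hj => ?_
    rw [if_neg (Finset.ne_of_mem_erase hj)]
  conv_lhs => rw [eq_sum_mono F]
  conv_rhs => rw [eq_sum_mono F]
  simp only [map_sum, map_smul, key, coeff_sum, coeff_smul, Finset.mul_sum, smul_eq_mul]
  refine Finset.sum_congr rfl fun m _ => ?_
  rw [← monomial_eq_mono, coeff_monomial]
  split_ifs with h
  · subst h; ring
  · simp

/-- Explicit spanning family of the space of polynomials admitting a boundary decomposition. -/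
def boundaryGenerators (k : ℕ) (η : ℂ) : Set (MvPolynomial (Fin k) ℂ) :=
  { p | (∃ i : Fin k, i.val = 0 ∧ ∃ e : Fin k → ℕ, (∀ t, e t ≤ 2) ∧ e i = 0 ∧
      p = (X i + C η) * mono e) ∨
    ∃ i j : Fin k, i.val + 1 = j.val ∧ ∃ e : Fin k → ℕ, (∀ t, e t ≤ 2) ∧ e i ≤ 1 ∧ e j ≤ 1 ∧
      p = (X i - X j - 1) * (mono e + mono (e ∘ Equiv.swap i j)) }

lemma X_add_C_mul_mono_mem_Rspace {i : Fin k} {e : Fin k → ℕ} (he : ∀ t, e t ≤ 2)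
    (hi : e i = 0) (η : ℂ) : (X i + C η) * mono e ∈ Rspace k := by
  rw [add_mul, X_mul_mono, ← smul_eq_C_mul]
  refine add_mem (mono_mem_Rspace fun t => ?_) (Submodule.smul_mem _ _ (mono_mem_Rspace he))
  rw [Function.update_apply]
  split_ifs with h
  · omega
  · exact he t

lemma X_sub_X_sub_one_mul_mono_mem_Rspace {i j : Fin k} {e : Fin k → ℕ} (he : ∀ t, e t ≤ 2)
    (hi : e i ≤ 1) (hj : e j ≤ 1) : (X i - X j - 1) * mono e ∈ Rspace k := by
  rw [sub_mul, sub_mul, X_mul_mono, X_mul_mono, one_mul]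
  refine sub_mem (sub_mem (mono_mem_Rspace fun t => ?_) (mono_mem_Rspace fun t => ?_))
    (mono_mem_Rspace he) <;>
  · rw [Function.update_apply]
    split_ifs with h
    · omega
    · exact he t

lemma ne_zero_and_sub_one_eq {i j : Fin k} [NeZero k] (h : i.val + 1 = j.val) : j ≠ 0 ∧ j - 1 = i := by
  obtain ⟨n, rfl⟩ := Nat.exists_eq_succ_of_ne_zero (NeZero.ne k)
  have hj : j ≠ 0 := by
    rintro rfl
    simp at h
  refine ⟨hj, Fin.ext ?_⟩
  rw [Fin.coe_sub_one, if_neg hj]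
  omega

lemma sub_one_val_add_one [NeZero k] {j : Fin k} (hj : j ≠ 0) : (j - 1).val + 1 = j.val := by
  obtain ⟨n, rfl⟩ := Nat.exists_eq_succ_of_ne_zero (NeZero.ne k)
  rw [Fin.coe_sub_one, if_neg hj]
  have : j.val ≠ 0 := fun h => hj (Fin.ext h)
  omega

lemma X_add_C_mul_mem_span [NeZero k] {η : ℂ} {F : MvPolynomial (Fin k) ℂ}
    (hF : aeval (fun j : Fin k => if j = 0 then -(X 0) else X j) F = F)
    (hR : (X 0 + C η) * F ∈ Rspace k) :
    (X 0 + C η) * F ∈ Submodule.span ℂ (boundaryGenerators k η) := by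
  have hc : coeff (Finsupp.single 0 1) (X (0 : Fin k) + C η) ≠ 0 := by
    simp [coeff_C, eq_comm]
  have hl : (X (0 : Fin k) + C η) ≠ 0 := fun h => hc (by rw [h, coeff_zero])
  rw [show (X 0 + C η) * F = _ from congrArg ((X 0 + C η) * ·) (eq_sum_mono F), Finset.mul_sum]
  refine Submodule.sum_mem _ fun e he => ?_
  rw [mul_smul_comm]
  refine Submodule.smul_mem _ _ (Submodule.subset_span (Or.inl ⟨0, by simp, e, fun t => ?_, ?_, rfl⟩))
  · have := le_of_mul_mem_Rspace hR he hl t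
    omega
  · have h1 := le_of_mul_mem_Rspace hR he hl 0
    have h2 := one_le_degreeOf hc
    have h3 := coeff_aeval_neg 0 F e
    rw [hF] at h3
    by_contra h0
    have h4 : e 0 = 1 := by omega
    rw [h4, pow_one, neg_one_mul, self_eq_neg] at h3
    exact mem_support_iff.1 he h3

lemma X_sub_X_sub_one_mul_mem_span {η : ℂ} {i j : Fin k} (hij : i.val + 1 = j.val)
    {F : MvPolynomial (Fin k) ℂ} (hF : rename (Equiv.swap i j) F = F)
    (hR : (X i - X j - 1) * F ∈ Rspace k) :
    (X i - X j - 1) * F ∈ Submodule.span ℂ (boundaryGenerators k η) := by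
  have hne : i ≠ j := by rintro rfl; omega
  have hci : coeff (Finsupp.single i 1) (X i - X j - 1 : MvPolynomial (Fin k) ℂ) ≠ 0 := by
    simp [coeff_X, coeff_one, hne.symm, Finsupp.single_left_inj, eq_comm (a := (0 : Fin k →₀ ℕ))]
  have hcj : coeff (Finsupp.single j 1) (X i - X j - 1 : MvPolynomial (Fin k) ℂ) ≠ 0 := by
    simp [coeff_X, coeff_one, hne, Finsupp.single_left_inj, eq_comm (a := (0 : Fin k →₀ ℕ))]
  have hl : (X i - X j - 1 : MvPolynomial (Fin k) ℂ) ≠ 0 := fun h => hci (by rw [h, coeff_zero])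
  have h2 : F = (2⁻¹ : ℂ) • ∑ e ∈ F.support, coeff e F • (mono e + mono (e ∘ Equiv.swap i j)) := by
    simp only [smul_add, Finset.sum_add_distrib]
    rw [← eq_sum_mono]
    have : ∑ e ∈ F.support, coeff e F • mono (e ∘ Equiv.swap i j) = F := by
      conv_rhs => rw [← hF, eq_sum_mono F]
      simp [map_sum, rename_mono]
    rw [this, ← add_smul]
    norm_num
  rw [show (X i - X j - 1) * F = _ from congrArg ((X i - X j - 1) * ·) h2, mul_smul_comm, Finset.mul_sum]
  refine Submodule.smul_mem _ _ (Submodule.sum_mem _ fun e he => ?_)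
  rw [mul_smul_comm]
  have hi := one_le_degreeOf hci
  have hj := one_le_degreeOf hcj
  have hd := le_of_mul_mem_Rspace hR he hl
  refine Submodule.smul_mem _ _ (Submodule.subset_span (Or.inr ⟨i, j, hij, e, fun t => ?_, ?_, ?_, rfl⟩))
  · have := hd t
    omega
  · have := hd i
    omega
  · have := hd j
    omega

lemma span_BDset [NeZero k] (η : ℝ) :
    Submodule.span ℂ (BDset k η) = Submodule.span ℂ (boundaryGenerators k η) := by
  apply le_antisymm
  · refine Submodule.span_le.2 ?_
    rintro p ⟨-, F, h0, h0R, hi, rfl⟩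
    refine add_mem (X_add_C_mul_mem_span h0 h0R) (Submodule.sum_mem _ fun i hi0 => ?_)
    have hi0 := (Finset.mem_filter.1 hi0).2
    exact X_sub_X_sub_one_mul_mem_span (sub_one_val_add_one hi0) (hi i hi0).1 (hi i hi0).2
  · refine Submodule.span_mono ?_
    rintro p (⟨i, hi0, e, he, hei, rfl⟩ | ⟨i, j, hij, e, he, hei, hej, rfl⟩)
    · obtain rfl : i = 0 := Fin.ext (by simpa using hi0)
      have hR := X_add_C_mul_mono_mem_Rspace he hei (η : ℂ)
      refine ⟨hR, Pi.single 0 (mono e), ?_, by simpa using hR, fun i hi => by simp [hi], ?_⟩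
      · simp only [Pi.single_eq_same, mono, map_prod, map_pow, aeval_X]
        refine Finset.prod_congr rfl fun j _ => ?_
        split_ifs with h
        · subst h; simp [hei]
        · rfl
      · rw [Finset.sum_eq_zero, add_zero, Pi.single_eq_same]
        intro i hi
        simp [(Finset.mem_filter.1 hi).2]
    · obtain ⟨hj0, rfl⟩ := ne_zero_and_sub_one_eq hij
      have hR : (X (j - 1) - X j - 1) * (mono e + mono (e ∘ Equiv.swap (j - 1) j)) ∈ Rspace k := by
        rw [mul_add]
        exact add_mem (X_sub_X_sub_one_mul_mono_mem_Rspace he hei hej)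
          (X_sub_X_sub_one_mul_mono_mem_Rspace (fun t => he _) (by simpa) (by simpa))
      refine ⟨hR, Pi.single j (mono e + mono (e ∘ Equiv.swap (j - 1) j)), ?_, ?_, ?_, ?_⟩
      · simp [hj0.symm]
      · simp [hj0.symm]
      · intro i hi
        rcases eq_or_ne i j with rfl | h
        · refine ⟨?_, by simpa using hR⟩
          rw [Pi.single_eq_same, map_add, rename_mono, rename_mono, Equiv.symm_swap,
            Function.comp_assoc, add_comm]
          congr 2
          ext t
          simp
        · simp [h]
      · rw [Finset.sum_eq_single j]
        · simp [hj0.symm]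
        · intro i _ h
          simp [h]
        · simp [hj0]

lemma span_boundaryGenerators_le (η : ℂ) :
    Submodule.span ℂ (boundaryGenerators k η) ≤ Rspace k := by
  refine Submodule.span_le.2 ?_
  rintro p (⟨i, hi0, e, he, hei, rfl⟩ | ⟨i, j, hij, e, he, hei, hej, rfl⟩)
  · exact X_add_C_mul_mono_mem_Rspace he hei η
  · rw [mul_add]
    exact add_mem (X_sub_X_sub_one_mul_mono_mem_Rspace he hei hej)
      (X_sub_X_sub_one_mul_mono_mem_Rspace (fun t => he _) (by simpa) (by simpa))

/-- The transfer operator attached to the letter `z ^ m`: evaluate at `-(η + s)` and raise the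
state `s`, or extract the coefficient of `z ^ 2` and keep the state. -/
def letterOp (η : ℂ) (m : ℕ) : Module.End ℂ (ℕ → ℂ) where
  toFun f s := (-(η + s)) ^ m * f (s + 1) + if m = 2 then f s else 0
  map_add' f g := by
    ext s
    simp only [Pi.add_apply]
    split_ifs <;> ring
  map_smul' c f := by
    ext s
    simp only [Pi.smul_apply, smul_eq_mul, RingHom.id_apply]
    split_ifs <;> ring

lemma letterOp_apply (η : ℂ) (m : ℕ) (f : ℕ → ℂ) (s : ℕ) :
    letterOp η m f s = (-(η + s)) ^ m * f (s + 1) + if m = 2 then f s else 0 := rfl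

/-- The linear extension of the ordered product of transfer operators over monomials. -/
noncomputable def wordOp (k : ℕ) (η : ℂ) :
    MvPolynomial (Fin k) ℂ →ₗ[ℂ] Module.End ℂ (ℕ → ℂ) :=
  (basisMonomials (Fin k) ℂ).constr ℂ fun e => (List.ofFn fun i => letterOp η (e i)).prod

lemma wordOp_mono (η : ℂ) (e : Fin k → ℕ) :
    wordOp k η (mono e) = (List.ofFn fun i => letterOp η (e i)).prod := by
  have := (basisMonomials (Fin k) ℂ).constr_basis ℂ
    (fun e => (List.ofFn fun i => letterOp η (e i)).prod) (Finsupp.equivFunOnFinite.symm e)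
  rw [coe_basisMonomials] at this
  rw [mono_eq_monomial]
  exact this

lemma List.exists_prod_ofFn_adjacent {A : Type*} [Monoid A] {k : ℕ} (i j : Fin k)
    (h : i.val + 1 = j.val) (f : Fin k → A) :
    ∃ P S : A, ∀ g : Fin k → A, (∀ t, t ≠ i → t ≠ j → g t = f t) →
      (List.ofFn g).prod = P * (g i * g j) * S := by
  induction k with
  | zero => exact i.elim0
  | succ k ih =>
    induction i using Fin.cases with
    | zero =>
      obtain ⟨n, rfl⟩ : ∃ n, k = n + 1 := ⟨k - 1, by have := j.isLt; simp at h; omega⟩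
      obtain rfl : j = 1 := Fin.ext (by simpa using h.symm)
      refine ⟨1, (List.ofFn fun t : Fin n => f t.succ.succ).prod, fun g hg => ?_⟩
      rw [List.ofFn_succ, List.ofFn_succ, List.prod_cons, List.prod_cons, one_mul, mul_assoc]
      congr 3
      congr 1
      ext t
      exact hg _ (Fin.succ_ne_zero _) fun h => Fin.succ_ne_zero t (Fin.succ_injective _ h)
    | succ i =>
      induction j using Fin.cases with
      | zero => simp at h
      | succ j =>
        obtain ⟨P, S, hPS⟩ := ih i j (by simpa using h) fun t => f t.succ
        refine ⟨f 0 * P, S, fun g hg => ?_⟩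
        rw [List.ofFn_succ, List.prod_cons, hPS (fun t => g t.succ) fun t h1 h2 =>
          hg _ (fun h => h1 (Fin.succ_injective _ h)) fun h => h2 (Fin.succ_injective _ h),
          hg 0 (Fin.succ_ne_zero _).symm (Fin.succ_ne_zero _).symm]
        simp only [mul_assoc]

lemma letterOp_relation (η : ℂ) {x y : ℕ} (hx : x ≤ 1) (hy : y ≤ 1) :
    letterOp η (x + 1) * letterOp η y - letterOp η x * letterOp η (y + 1)
      - letterOp η x * letterOp η y + (letterOp η (y + 1) * letterOp η x
      - letterOp η y * letterOp η (x + 1) - letterOp η y * letterOp η x) = 0 := by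
  refine LinearMap.ext fun f => funext fun s => ?_
  interval_cases x <;> interval_cases y <;>
  · simp [letterOp_apply]
    ring

lemma wordOp_eq_zero {η : ℂ} {p : MvPolynomial (Fin k) ℂ}
    (hp : p ∈ Submodule.span ℂ (boundaryGenerators k η)) (f : ℕ → ℂ) : wordOp k η p f 0 = 0 := by
  induction hp using Submodule.span_induction with
  | zero => simp
  | add p q _ _ hp hq => simp [hp, hq]
  | smul c p _ hp => simp [hp]
  | mem p hp =>
    rcases hp with ⟨i, hi0, e, he, hei, rfl⟩ | ⟨i, j, hij, e, he, hei, hej, rfl⟩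
    · obtain ⟨n, rfl⟩ := Nat.exists_eq_succ_of_ne_zero (Nat.ne_of_gt i.pos)
      obtain rfl : i = 0 := Fin.ext hi0
      rw [add_mul, X_mul_mono, ← smul_eq_C_mul, map_add, map_smul, wordOp_mono, wordOp_mono,
        List.ofFn_succ, List.ofFn_succ, List.prod_cons, List.prod_cons]
      simp [hei, letterOp_apply]
    · have hne : i ≠ j := by rintro rfl; omega
      obtain ⟨P, S, h⟩ := List.exists_prod_ofFn_adjacent i j hij fun t => letterOp η (e t)
      have key : ∀ g : Fin k → ℕ, (∀ t, t ≠ i → t ≠ j → g t = e t) →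
          wordOp k η (mono g) = P * (letterOp η (g i) * letterOp η (g j)) * S := by
        intro g hg
        rw [wordOp_mono]
        exact h _ fun t h1 h2 => by rw [hg t h1 h2]
      have : wordOp k η ((X i - X j - 1) * (mono e + mono (e ∘ Equiv.swap i j)))
          = P * 0 * S := by
        rw [← letterOp_relation η hei hej]
        simp only [sub_mul, mul_add, one_mul, X_mul_mono, map_sub, map_add]
        rw [key, key, key, key, key, key]
        · simp [hne, hne.symm]
          simp only [mul_sub, add_mul, sub_mul]
        all_goals
          intro t h1 h2
          simp [h1, h2, Equiv.swap_apply_of_ne_of_ne]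
      rw [this]
      simp

/-- Append the letter `z ^ x` in a new last variable. -/
noncomputable def appendLetter (k x : ℕ) :
    MvPolynomial (Fin k) ℂ →ₗ[ℂ] MvPolynomial (Fin (k + 1)) ℂ :=
  LinearMap.mulRight ℂ (X (Fin.last k) ^ x) ∘ₗ (rename Fin.castSucc).toLinearMap

lemma appendLetter_apply (x : ℕ) (p : MvPolynomial (Fin k) ℂ) :
    appendLetter k x p = rename Fin.castSucc p * X (Fin.last k) ^ x := rfl

lemma appendLetter_mono (x : ℕ) (e : Fin k → ℕ) :
    appendLetter k x (mono e) = mono (Fin.snoc e x : Fin (k + 1) → ℕ) := by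
  simp [appendLetter_apply, mono, Fin.prod_univ_castSucc]

lemma snoc_le_two {e : Fin k → ℕ} (he : ∀ t, e t ≤ 2) {x : ℕ} (hx : x ≤ 2) (t : Fin (k + 1)) :
    (Fin.snoc e x : Fin (k + 1) → ℕ) t ≤ 2 := by
  induction t using Fin.lastCases with
  | last => simpa
  | cast t => simpa using he t

lemma snoc_comp_swap (e : Fin k → ℕ) (x : ℕ) (i j : Fin k) :
    (Fin.snoc (e ∘ Equiv.swap i j) x : Fin (k + 1) → ℕ)
      = (Fin.snoc e x : Fin (k + 1) → ℕ) ∘ Equiv.swap i.castSucc j.castSucc := by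
  ext t
  induction t using Fin.lastCases with
  | last =>
    simp [Equiv.swap_apply_of_ne_of_ne, (Fin.castSucc_lt_last _).ne']
  | cast t =>
    rw [Function.comp_apply, ← (Fin.castSucc_injective k).map_swap]
    simp

lemma appendLetter_mem_span {η : ℂ} {x : ℕ} (hx : x ≤ 2) {p : MvPolynomial (Fin k) ℂ}
    (hp : p ∈ Submodule.span ℂ (boundaryGenerators k η)) :
    appendLetter k x p ∈ Submodule.span ℂ (boundaryGenerators (k + 1) η) := by
  suffices Submodule.span ℂ (boundaryGenerators k η) ≤
      (Submodule.span ℂ (boundaryGenerators (k + 1) η)).comap (appendLetter k x) from this hp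
  refine Submodule.span_le.2 fun p hp => Submodule.subset_span ?_
  rcases hp with ⟨i, hi0, e, he, hei, rfl⟩ | ⟨i, j, hij, e, he, hei, hej, rfl⟩
  · refine Or.inl ⟨i.castSucc, hi0, (Fin.snoc e x : Fin (k + 1) → ℕ), snoc_le_two he hx,
      by simpa, ?_⟩
    rw [← appendLetter_mono, appendLetter_apply, appendLetter_apply]
    simp [mul_assoc]
  · refine Or.inr ⟨i.castSucc, j.castSucc, hij, (Fin.snoc e x : Fin (k + 1) → ℕ),
      snoc_le_two he hx, by simpa, by simpa, ?_⟩
    rw [← snoc_comp_swap, ← appendLetter_mono, ← appendLetter_mono, ← map_add,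
      appendLetter_apply, appendLetter_apply]
    simp [mul_assoc]

lemma appendLetter_relation (η : ℂ) {e : Fin k → ℕ} (he : ∀ t, e t ≤ 2) {x y : ℕ} (hx : x ≤ 1)
    (hy : y ≤ 1) :
    appendLetter _ y (appendLetter _ (x + 1) (mono e))
      - appendLetter _ (y + 1) (appendLetter _ x (mono e))
      - appendLetter _ y (appendLetter _ x (mono e))
      + (appendLetter _ x (appendLetter _ (y + 1) (mono e))
      - appendLetter _ (x + 1) (appendLetter _ y (mono e))
      - appendLetter _ x (appendLetter _ y (mono e))) ∈
      Submodule.span ℂ (boundaryGenerators (k + 2) η) := by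
  refine Submodule.subset_span (Or.inr ⟨(Fin.last k).castSucc, Fin.last (k + 1), rfl,
    (Fin.snoc (Fin.snoc e x : Fin (k + 1) → ℕ) y : Fin (k + 2) → ℕ),
    snoc_le_two (snoc_le_two he (by omega)) (by omega), by simpa, by simpa, ?_⟩)
  have hs : (Fin.snoc (Fin.snoc e x : Fin (k + 1) → ℕ) y : Fin (k + 2) → ℕ) ∘
      Equiv.swap (Fin.last k).castSucc (Fin.last (k + 1)) =
      (Fin.snoc (Fin.snoc e y : Fin (k + 1) → ℕ) x : Fin (k + 2) → ℕ) := by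
    ext t
    induction t using Fin.lastCases with
    | last => simp
    | cast t =>
      induction t using Fin.lastCases with
      | last => simp
      | cast t =>
        rw [Function.comp_apply, Equiv.swap_apply_of_ne_of_ne
          (fun h => (Fin.castSucc_lt_last t).ne (Fin.castSucc_injective _ h))
          (Fin.castSucc_lt_last _).ne]
        simp
  rw [hs, ← appendLetter_mono, ← appendLetter_mono, ← appendLetter_mono, ← appendLetter_mono]
  simp only [appendLetter_apply, map_mul, map_pow, rename_X]
  ring

/-- The exponents of the word `1 ⋯ 1 · z² ⋯ z²` with `r` leading trivial letters. -/
def normalWord (k r : ℕ) : Fin k → ℕ := fun t => if t.val < r then 0 else 2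

lemma normalWord_le (k r : ℕ) (t : Fin k) : normalWord k r t ≤ 2 := by
  unfold normalWord
  split_ifs <;> omega

lemma appendLetter_two_normalWord {k r : ℕ} (h : r ≤ k) :
    appendLetter k 2 (mono (normalWord k r)) = mono (normalWord (k + 1) r) := by
  rw [appendLetter_mono]
  congr 1
  ext t
  induction t using Fin.lastCases with
  | last => simp [normalWord, h]
  | cast t => simp [normalWord]

lemma appendLetter_zero_normalWord (k : ℕ) :
    appendLetter k 0 (mono (normalWord k k)) = mono (normalWord (k + 1) (k + 1)) := by
  rw [appendLetter_mono]
  congr 1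
  ext t
  induction t using Fin.lastCases with
  | last => simp [normalWord]
  | cast t => simp [normalWord, t.isLt, t.isLt.trans (Nat.lt_succ_self k)]

/-- The span of the boundary generators and the normal words with at most `l` letters `z²`. -/
noncomputable def normalSpan (k : ℕ) (η : ℂ) (l : ℕ) : Submodule ℂ (MvPolynomial (Fin k) ℂ) :=
  Submodule.span ℂ (boundaryGenerators k η) ⊔
    Submodule.span ℂ { p | ∃ r, r ≤ k ∧ k ≤ r + l ∧ p = mono (normalWord k r) }

lemma normalWord_mem_normalSpan {k r l : ℕ} (η : ℂ) (h1 : r ≤ k) (h2 : k ≤ r + l) :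
    mono (normalWord k r) ∈ normalSpan k η l :=
  Submodule.mem_sup_right (Submodule.subset_span ⟨r, h1, h2, rfl⟩)

lemma normalSpan_mono {k l l' : ℕ} (η : ℂ) (h : l ≤ l') : normalSpan k η l ≤ normalSpan k η l' := by
  refine sup_le_sup_left (Submodule.span_mono ?_) _
  rintro _ ⟨r, h1, h2, rfl⟩
  exact ⟨r, h1, by omega, rfl⟩

lemma appendLetter_normalSpan {k l l' x : ℕ} {η : ℂ} (hx : x ≤ 2)
    (h : ∀ r, r ≤ k → k ≤ r + l →
      appendLetter k x (mono (normalWord k r)) ∈ normalSpan (k + 1) η l') :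
    ∀ p ∈ normalSpan k η l, appendLetter k x p ∈ normalSpan (k + 1) η l' := by
  refine show normalSpan k η l ≤ (normalSpan (k + 1) η l').comap (appendLetter k x) from
    sup_le (fun p hp => Submodule.mem_sup_left (appendLetter_mem_span hx hp))
      (Submodule.span_le.2 ?_)
  rintro _ ⟨r, h1, h2, rfl⟩
  exact h r h1 h2

lemma appendLetter_two_mem_normalSpan {k l : ℕ} {η : ℂ} :
    ∀ p ∈ normalSpan k η l, appendLetter k 2 p ∈ normalSpan (k + 1) η (l + 1) := by
  refine appendLetter_normalSpan le_rfl fun r h1 h2 => ?_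
  rw [appendLetter_two_normalWord h1]
  exact normalWord_mem_normalSpan η (by omega) (by omega)

lemma appendLetter_one_normalWord (k : ℕ) (η : ℂ) :
    appendLetter k 1 (mono (normalWord k k)) ∈ normalSpan (k + 1) η 0 := by
  induction k with
  | zero =>
    have h1 : (X 0 + C η) * mono 0 ∈ normalSpan 1 η 0 :=
      Submodule.mem_sup_left (Submodule.subset_span
        (Or.inl ⟨0, rfl, 0, by simp, rfl, rfl⟩))
    have h2 : mono (normalWord 1 1) ∈ normalSpan 1 η 0 :=
      normalWord_mem_normalSpan η le_rfl le_rfl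
    convert sub_mem h1 (Submodule.smul_mem _ η h2) using 1
    simp [appendLetter_apply, mono, normalWord, smul_eq_C_mul]
  | succ k ih =>
    have h1 : _ ∈ normalSpan (k + 2) η 0 := Submodule.mem_sup_left
      (appendLetter_relation η (normalWord_le k k) (x := 0) (y := 0) zero_le_one zero_le_one)
    have h0 : ∀ p ∈ normalSpan (k + 1) η 0, appendLetter _ 0 p ∈ normalSpan (k + 2) η 0 := by
      refine appendLetter_normalSpan (by omega) fun r h1 h2 => ?_
      obtain rfl : r = k + 1 := by omega
      rw [appendLetter_zero_normalWord]
      exact normalWord_mem_normalSpan η (by omega) (by omega)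
    have h2 := h0 _ ih
    have h3 := h0 _ (normalWord_mem_normalSpan η le_rfl le_rfl)
    rw [← appendLetter_zero_normalWord] at h3 ⊢
    convert sub_mem (sub_mem h2 h3) (Submodule.smul_mem _ (2⁻¹ : ℂ) h1) using 1
    module

lemma appendLetter_mem_normalSpan {η : ℂ} (l : ℕ) :
    ∀ k x, x ≤ 1 → ∀ p ∈ normalSpan k η l, appendLetter k x p ∈ normalSpan (k + 1) η l := by
  induction l with
  | zero =>
    intro k x hx
    refine appendLetter_normalSpan (by omega) fun r h1 h2 => ?_
    obtain rfl : r = k := by omega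
    interval_cases x
    · rw [appendLetter_zero_normalWord]
      exact normalWord_mem_normalSpan η (by omega) (by omega)
    · exact appendLetter_one_normalWord r η
  | succ l ih =>
    intro k x hx
    refine appendLetter_normalSpan (by omega) fun r h1 h2 => ?_
    by_cases hr : k ≤ r + l
    · exact normalSpan_mono η (Nat.le_succ l) (ih k x hx _ (normalWord_mem_normalSpan η h1 hr))
    obtain ⟨n, rfl⟩ : ∃ n, k = n + 1 := ⟨k - 1, by omega⟩
    have hw := normalWord_mem_normalSpan (l := l) η (show r ≤ n by omega) (by omega)
    rw [← appendLetter_two_normalWord (by omega)]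
    have hrel : ∀ {y z}, y ≤ 1 → z ≤ 1 → _ ∈ normalSpan (n + 2) η (l + 1) := fun {y z} hy hz =>
      Submodule.mem_sup_left (appendLetter_relation η (normalWord_le n r) (x := y) (y := z) hy hz)
    have h2 : ∀ {y}, y ≤ 1 → _ := fun {y} hy =>
      appendLetter_two_mem_normalSpan _ (ih n y hy _ hw)
    have h1 : ∀ {y z}, y ≤ 1 → z ≤ 1 → _ := fun {y z} hy hz =>
      normalSpan_mono η (Nat.le_succ l) (ih (n + 1) z hz _ (ih n y hy _ hw))
    interval_cases x
    · convert add_mem (hrel (y := 1) (z := 0) le_rfl zero_le_one)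
        (add_mem (h2 (y := 0) zero_le_one) (add_mem (h1 (y := 1) (z := 0) le_rfl zero_le_one)
          (h1 (y := 0) (z := 1) zero_le_one le_rfl))) using 1
      module
    · convert add_mem (Submodule.smul_mem _ (2⁻¹ : ℂ) (hrel (y := 1) (z := 1) le_rfl le_rfl))
        (add_mem (h2 (y := 1) le_rfl) (h1 (y := 1) (z := 1) le_rfl le_rfl)) using 1
      module

lemma mono_mem_normalSpan (η : ℂ) (k : ℕ) (e : Fin k → ℕ) (he : ∀ t, e t ≤ 2) :
    mono e ∈ normalSpan k η k := by
  induction k with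
  | zero =>
    rw [Subsingleton.elim e (normalWord 0 0)]
    exact normalWord_mem_normalSpan η le_rfl le_rfl
  | succ k ih =>
    have h := ih (fun t => e t.castSucc) fun t => he _
    rw [← Fin.snoc_init_self e, ← appendLetter_mono]
    have hl := he (Fin.last k)
    rcases Nat.lt_or_ge (e (Fin.last k)) 2 with h2 | h2
    · exact normalSpan_mono η (Nat.le_succ k)
        (appendLetter_mem_normalSpan k k _ (by omega) _ h)
    · rw [show e (Fin.last k) = 2 by omega]
      exact appendLetter_two_mem_normalSpan _ h

/-- The functionals `p ↦ (wordOp k η p δ_s) 0` for `s ≤ k`; they vanish on the boundary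
generators. -/
noncomputable def stateFunctional (k : ℕ) (η : ℂ) :
    MvPolynomial (Fin k) ℂ →ₗ[ℂ] Fin (k + 1) → ℂ where
  toFun p s := wordOp k η p (Pi.single s.val 1) 0
  map_add' p q := by ext; simp
  map_smul' c p := by ext; simp

lemma letterOp_two_prod_apply (η : ℂ) (n : ℕ) {s r : ℕ} (h : s ≤ r) :
    (List.ofFn fun _ : Fin n => letterOp η 2).prod (Pi.single s 1) r =
      if s = r then 1 else 0 := by
  induction n generalizing r with
  | zero => simp [Pi.single_apply, eq_comm]
  | succ n ih =>
    rw [List.ofFn_succ, List.prod_cons, Module.End.mul_apply, letterOp_apply, ih (by omega), ih h]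
    simp [show s ≠ r + 1 by omega]

lemma prod_letterOp_normalWord (η : ℂ) (k r : ℕ) (f : ℕ → ℂ) (a : ℕ) (h : r ≤ k) :
    (List.ofFn fun i => letterOp η (normalWord k r i)).prod f a =
      (List.ofFn fun _ : Fin (k - r) => letterOp η 2).prod f (a + r) := by
  induction r generalizing k a with
  | zero => simp [normalWord]
  | succ r ih =>
    obtain ⟨n, rfl⟩ : ∃ n, k = n + 1 := ⟨k - 1, by omega⟩
    have h1 : ∀ i : Fin n, normalWord (n + 1) (r + 1) i.succ = normalWord n r i := fun i => by
      simp [normalWord]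
    rw [List.ofFn_succ, List.prod_cons, Module.End.mul_apply, letterOp_apply]
    simp only [h1, ih n _ (Nat.le_of_succ_le_succ h)]
    simp [normalWord, add_assoc, add_comm 1]

lemma linearIndependent_stateFunctional (k : ℕ) (η : ℂ) :
    LinearIndependent ℂ
      (stateFunctional k η ∘ fun r : Fin (k + 1) => mono (normalWord k r.val)) := by
  have key : ∀ r s : Fin (k + 1), s ≤ r → stateFunctional k η (mono (normalWord k r.val)) s =
      if s = r then 1 else 0 := by
    intro r s hsr
    change wordOp k η _ _ 0 = _
    rw [wordOp_mono, prod_letterOp_normalWord _ _ _ _ _ (Nat.lt_succ_iff.1 r.isLt), zero_add,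
      letterOp_two_prod_apply _ _ hsr]
    simp [Fin.ext_iff]
  let M : Matrix (Fin (k + 1)) (Fin (k + 1)) ℂ :=
    Matrix.of fun r s => stateFunctional k η (mono (normalWord k r.val)) s
  have hM : M.det = 1 := by
    rw [Matrix.det_of_isUpperTriangular]
    · exact Finset.prod_eq_one fun i _ => by simp [M, key]
    · intro r s h
      have h : s < r := h
      simp [M, key r s h.le, h.ne]
  exact Matrix.linearIndependent_rows_of_isUnit (A := M)
    ((Matrix.isUnit_iff_isUnit_det M).2 (by simp [hM]))

lemma finrank_Rspace (k : ℕ) : Module.finrank ℂ (Rspace k) = 3 ^ k := by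
  have h : Rspace k =
      Submodule.span ℂ (Set.range fun e : Fin k → Fin 3 => mono fun t => (e t : ℕ)) := by
    rw [Rspace]
    congr 1
    ext p
    constructor
    · rintro ⟨e, he, rfl⟩
      exact ⟨fun t => ⟨e t, Nat.lt_succ_of_le (he t)⟩, (monomial_eq_mono e).symm⟩
    · rintro ⟨e, rfl⟩
      exact ⟨_, fun t => Nat.lt_succ_iff.1 (e t).isLt, mono_eq_monomial _⟩
  have hli : LinearIndependent ℂ fun e : Fin k → Fin 3 => mono fun t => (e t : ℕ) := by
    have := (basisMonomials (Fin k) ℂ).linearIndependent.comp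
      (fun e : Fin k → Fin 3 => Finsupp.equivFunOnFinite.symm fun t => (e t : ℕ)) (by
        intro e e' h
        ext t
        exact congrFun (Finsupp.equivFunOnFinite.symm.injective h) t)
    rw [coe_basisMonomials] at this
    simp only [mono_eq_monomial]
    exact this
  rw [h, finrank_span_eq_card hli]
  simp

lemma finrank_span_boundaryGenerators (k : ℕ) (η : ℂ) :
    Module.finrank ℂ (Submodule.span ℂ (boundaryGenerators k η)) + (k + 1) = 3 ^ k := by
  set w : Fin (k + 1) → MvPolynomial (Fin k) ℂ := fun r => mono (normalWord k r.val) with hw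
  set B := Submodule.span ℂ (boundaryGenerators k η)
  have hfin : FiniteDimensional ℂ (Rspace k) :=
    Module.finite_of_finrank_pos (by rw [finrank_Rspace]; positivity)
  have : FiniteDimensional ℂ B :=
    Submodule.finiteDimensional_of_le (span_boundaryGenerators_le η)
  have : FiniteDimensional ℂ (Submodule.span ℂ (Set.range w)) :=
    FiniteDimensional.span_of_finite ℂ (Set.finite_range w)
  have hli := linearIndependent_stateFunctional k η
  have hU := finrank_span_eq_card (LinearIndependent.of_comp _ hli)
  have hsup : B ⊔ Submodule.span ℂ (Set.range w) = Rspace k := by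
    apply le_antisymm
    · refine sup_le (span_boundaryGenerators_le η) (Submodule.span_le.2 ?_)
      rintro _ ⟨r, rfl⟩
      exact mono_mem_Rspace (normalWord_le k r)
    · refine Submodule.span_le.2 ?_
      rintro _ ⟨e, he, rfl⟩
      rw [monomial_eq_mono]
      refine sup_le_sup_left (Submodule.span_mono ?_) B (mono_mem_normalSpan η k e he)
      rintro _ ⟨r, hr, -, rfl⟩
      exact ⟨⟨r, Nat.lt_succ_of_le hr⟩, rfl⟩
  have hinf : B ⊓ Submodule.span ℂ (Set.range w) = ⊥ := by
    rw [eq_bot_iff]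
    rintro p ⟨hpB, hpw⟩
    obtain ⟨c, rfl⟩ := (Submodule.mem_span_range_iff_exists_fun ℂ).1 hpw
    have h0 : stateFunctional k η (∑ i, c i • w i) = 0 :=
      funext fun s => wordOp_eq_zero hpB _
    rw [map_sum] at h0
    simp only [map_smul] at h0
    have hc := Fintype.linearIndependent_iff.1 hli c h0
    simp [hc]
  have h := Submodule.finrank_sup_add_finrank_inf_eq B (Submodule.span ℂ (Set.range w))
  rw [hsup, hinf, finrank_bot, finrank_Rspace, hU, Fintype.card_fin] at h
  omega

end BoundaryDecomposition

/-- The space `BD_k` has dimension `3^k − k − 1`. -/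
theorem BD_finrank (k : ℕ) [NeZero k] (η : ℝ) (hη : 0 < η) :
    Module.finrank ℂ (Submodule.span ℂ (BDset k η)) = 3 ^ k - k - 1 := by
  rw [span_BDset, Nat.sub_sub]
  exact Nat.eq_sub_of_add_eq (finrank_span_boundaryGenerators k η)
end

section
/- For every 1 ≤ r ≤ k−1 and every choice of exponents i_1,…,i_{r−1} ∈ {0,1,2}, the polynomial (∏_{j=1}^{r−1} z_j^{i_j}) · z_r z_{r+1}⋯z_k · (z_r − (k−r)) belongs to BD_k + span(L_k^2). -/
open MvPolynomial

/-- A monomial with exponents at most `2` lies in `R_k`. -/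
lemma monomial_mem_Rspace {k : ℕ} {f : Fin k →₀ ℕ} (hf : ∀ j, f j ≤ 2) :
    monomial f (1 : ℂ) ∈ Rspace k :=
  Submodule.subset_span ⟨f, hf, rfl⟩

lemma X_mul_monomial_one {σ : Type*} (i : σ) (f : σ →₀ ℕ) :
    X i * monomial f (1 : ℂ) = monomial (Finsupp.single i 1 + f) 1 := by
  simp [X, monomial_mul]

lemma single_add_apply_le_two {σ : Type*} {f : σ →₀ ℕ} (hf : ∀ j, f j ≤ 2) {i : σ}
    (hi : f i ≤ 1) (j : σ) : (Finsupp.single i 1 + f : σ →₀ ℕ) j ≤ 2 := by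
  classical
  rw [Finsupp.add_apply, Finsupp.single_apply]
  split_ifs with h
  · subst h; omega
  · simpa using hf j

/-- Multiplying a monomial having exponent `1` in both `z_{i-1}` and `z_i` by
`z_{i-1} - z_i - 1` yields an element of `BD_k`. -/
lemma sub_sub_one_mul_monomial_mem_BDset {k : ℕ} [NeZero k] (η : ℝ) {f : Fin k →₀ ℕ}
    (hf : ∀ j, f j ≤ 2) {i : Fin k} (hi : i ≠ 0) (h1 : f (i - 1) = 1) (h2 : f i = 1) :
    (X (i - 1) - X i - 1) * monomial f (1 : ℂ) ∈ BDset k η := by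
  have hR : (X (i - 1) - X i - 1) * monomial f (1 : ℂ) ∈ Rspace k := by
    rw [sub_mul, sub_mul, one_mul, X_mul_monomial_one, X_mul_monomial_one]
    exact sub_mem (sub_mem (monomial_mem_Rspace (single_add_apply_le_two hf h1.le))
      (monomial_mem_Rspace (single_add_apply_le_two hf h2.le))) (monomial_mem_Rspace hf)
  refine ⟨hR, Pi.single i (monomial f 1), ?_, ?_, fun j _ => ?_, ?_⟩
  · simp [Pi.single_eq_of_ne hi.symm]
  · simp [Pi.single_eq_of_ne hi.symm]
  · by_cases hji : j = i
    · subst hji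
      refine ⟨?_, by simpa using hR⟩
      rw [Pi.single_eq_same, rename_monomial]
      refine congrArg (monomial · (1 : ℂ)) ?_
      rw [← Finsupp.equivMapDomain_eq_mapDomain]
      ext m
      rw [Finsupp.equivMapDomain_apply, Equiv.symm_swap, Equiv.swap_apply_def]
      split_ifs with ha hb
      · rw [ha, h1, h2]
      · rw [hb, h1, h2]
      · rfl
    · simp [Pi.single_eq_of_ne hji]
  · rw [Pi.single_eq_of_ne hi.symm, mul_zero, zero_add, Finset.sum_eq_single_of_mem i (by simp [hi])]
    · rw [Pi.single_eq_same]
    · intro j _ hji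
      rw [Pi.single_eq_of_ne hji, mul_zero]

/-- Telescoping the generators along consecutive variables `z_a, …, z_{a+n}`, all having
exponent `1`. -/
lemma sub_sub_natCast_mul_monomial_mem_span_BDset {k : ℕ} [NeZero k] (η : ℝ) {f : Fin k →₀ ℕ}
    (hf : ∀ j, f j ≤ 2) {a : ℕ} (h1 : ∀ j : Fin k, a ≤ j → f j = 1) (n : ℕ) (hn : a + n < k) :
    (X ⟨a, by omega⟩ - X ⟨a + n, hn⟩ - C (n : ℂ)) * monomial f (1 : ℂ) ∈
      Submodule.span ℂ (BDset k η) := by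
  induction n with
  | zero => simp
  | succ n ih =>
    have hi : (⟨a + (n + 1), hn⟩ : Fin k) ≠ 0 := by simp [Fin.ext_iff]
    have hpred : (⟨a + (n + 1), hn⟩ : Fin k) - 1 = ⟨a + n, by omega⟩ := by
      ext
      rw [Fin.val_sub_one_of_ne_zero hi]
      simp only
      omega
    have step := sub_sub_one_mul_monomial_mem_BDset η hf hi
      (h1 _ (by rw [hpred]; simp)) (h1 _ (by simp))
    rw [hpred] at step
    convert add_mem (ih (by omega)) (Submodule.subset_span step) using 1
    push_cast
    rw [C_add, C_1]
    ring

/-- Lemma 4.2 of the paper: for `1 ≤ r ≤ k−1` and exponents `i_j ∈ {0,1,2}`,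
`(∏_{j=1}^{r−1} z_j^{i_j}) · z_r⋯z_k · (z_r − (k−r)) ∈ BD_k + span(L_k²)`. -/
theorem basic_telescope (k : ℕ) [NeZero k] (η : ℝ) (hη : 0 < η)
    (r : ℕ) (hr1 : 1 ≤ r) (hr2 : r ≤ k - 1) (e : Fin k → ℕ) (he : ∀ j, e j ≤ 2) :
    (∏ j ∈ Finset.univ.filter (fun j : Fin k => (j : ℕ) < r - 1), X j ^ e j) *
        (∏ j ∈ Finset.univ.filter (fun j : Fin k => r - 1 ≤ (j : ℕ)), X j) *
        (X (⟨r - 1, by omega⟩ : Fin k) - C ((k - r : ℕ) : ℂ))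
      ∈ Submodule.span ℂ (BDset k η) ⊔ Submodule.span ℂ (Lset k 2) := by
  classical
  set f : Fin k →₀ ℕ :=
    Finsupp.equivFunOnFinite.symm fun j => if (j : ℕ) < r - 1 then e j else 1 with hfdef
  have hf : ∀ j, f j ≤ 2 := by
    intro j
    simp only [hfdef, Finsupp.coe_equivFunOnFinite_symm]
    split_ifs
    · exact he j
    · omega
  have h1 : ∀ j : Fin k, r - 1 ≤ j → f j = 1 := by
    intro j hj
    simp [hfdef, hj.not_gt]
  have hprod : (∏ j ∈ Finset.univ.filter (fun j : Fin k => (j : ℕ) < r - 1), X j ^ e j) *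
      (∏ j ∈ Finset.univ.filter (fun j : Fin k => r - 1 ≤ (j : ℕ)), X j) =
      monomial f (1 : ℂ) := by
    rw [monomial_eq, C_1, one_mul, Finsupp.prod_fintype _ _ (by simp),
      ← Finset.prod_filter_mul_prod_filter_not Finset.univ (fun j : Fin k => (j : ℕ) < r - 1)]
    simp only [not_lt]
    congr 1
    · refine Finset.prod_congr rfl fun j hj => ?_
      simp [hfdef, (Finset.mem_filter.mp hj).2]
    · refine Finset.prod_congr rfl fun j hj => ?_
      rw [h1 j (Finset.mem_filter.mp hj).2, pow_one]
  have hlast : r - 1 + (k - r) < k := by omega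
  have hL : X ⟨r - 1 + (k - r), hlast⟩ * monomial f (1 : ℂ) ∈ Submodule.span ℂ (Lset k 2) := by
    rw [X_mul_monomial_one]
    refine Submodule.subset_span
      ⟨_, single_add_apply_le_two hf (h1 _ (Nat.le_add_right _ _)).le, fun j hj => ?_, rfl⟩
    obtain rfl : j = ⟨r - 1 + (k - r), hlast⟩ := by
      ext
      simp only
      omega
    rw [Finsupp.add_apply, Finsupp.single_eq_same, h1 _ (by simp)]
  rw [hprod]
  convert Submodule.add_mem_sup
    (sub_sub_natCast_mul_monomial_mem_span_BDset η hf h1 (k - r) hlast) hL using 1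
  ring
end
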